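/- arXiv:2411.00291 — 2 statements merged into one kernel-verified Lean document; each statement's English description precedes it below -/
import Mathlib

section
/- Let U ⊂ ℝ^{1+3} be open, let r, π : U → ℝ be differentiable and strictly positive, let u : U → ℝ^4 be differentiable, and let λ, ζ : ℝ → ℝ be differentiable. If equations (i) and (iii) of the Israel–Stewart system hold on U, then pointwise on U: D_t(π/r) = - (π/r) - λ(r^{1/κ}) r^{2+1/κ} (π/r)^{3+1/κ} - ( ζ(r^{1/κ}) / (r π^{1+1/κ}) ) ∂_μ u^μ + κ (r+1) (π/r) ∂_μ u^μ + κ r^2 (π/r)^{3+1/κ} ∂_μ u^μ. -/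
open Set

/-- Partial derivative `∂_μ` on `ℝ^{1+3}`. -/
noncomputable def pd (μ : Fin 4) (f : (Fin 4 → ℝ) → ℝ) : (Fin 4 → ℝ) → ℝ :=
  fun x => fderiv ℝ f x (Pi.single μ 1)

/-- The divergence `∂_μ u^μ` of a vector field on `ℝ^{1+3}`. -/
noncomputable def divu (u : (Fin 4 → ℝ) → Fin 4 → ℝ) (x : Fin 4 → ℝ) : ℝ :=
  ∑ μ, pd μ (fun y => u y μ) x

/-- The material derivative `D_t f = u^μ ∂_μ f`. -/
noncomputable def Dt (u : (Fin 4 → ℝ) → Fin 4 → ℝ) (f : (Fin 4 → ℝ) → ℝ)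
    (x : Fin 4 → ℝ) : ℝ :=
  ∑ μ, u x μ * pd μ f x

/-- Equation (i) of the Israel–Stewart system in the variables `(r,u,π)`:
`u^μ ∂_μ r + κ r a_1 ∂_μ u^μ = 0`, with `a_1 = r + 1 + r^2 (π/r)^{2+1/κ}`. -/
def EqI (κ : ℝ) (r : (Fin 4 → ℝ) → ℝ) (u : (Fin 4 → ℝ) → Fin 4 → ℝ)
    (pbar : (Fin 4 → ℝ) → ℝ) (x : Fin 4 → ℝ) : Prop :=
  Dt u r x + κ * r x * (r x + 1 + (r x) ^ 2 * (pbar x / r x) ^ ((2:ℝ) + 1/κ)) * divu u x = 0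

/-- Equation (iii) of the Israel–Stewart system:
`u^μ ∂_μ π + π + λ(r^{1/κ}) π^{3+1/κ} + r a_4 ∂_μ u^μ = 0`,
with `a_4 = ζ(r^{1/κ})/(r π^{1+1/κ})`. -/
def EqIII (κ : ℝ) (lam zeta : ℝ → ℝ) (r : (Fin 4 → ℝ) → ℝ)
    (u : (Fin 4 → ℝ) → Fin 4 → ℝ) (pbar : (Fin 4 → ℝ) → ℝ) (x : Fin 4 → ℝ) : Prop :=
  Dt u pbar x + pbar x + lam (r x ^ (1/κ)) * pbar x ^ ((3:ℝ) + 1/κ)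
    + r x * (zeta (r x ^ (1/κ)) / (r x * pbar x ^ ((1:ℝ) + 1/κ))) * divu u x = 0

theorem Dt_div (u : (Fin 4 → ℝ) → Fin 4 → ℝ) {f g : (Fin 4 → ℝ) → ℝ} {x : Fin 4 → ℝ}
    (hf : DifferentiableAt ℝ f x) (hg : DifferentiableAt ℝ g x) (hgx : g x ≠ 0) :
    Dt u (fun y => f y / g y) x = Dt u f x / g x - f x / g x * (Dt u g x / g x) := by
  have hpd : ∀ μ, pd μ (fun y => f y / g y) x
      = pd μ f x / g x - f x / g x * (pd μ g x / g x) := by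
    intro μ
    have h : fderiv ℝ (fun y => f y / g y) x
        = f x • (-(g x ^ 2)⁻¹) • fderiv ℝ g x + (g x)⁻¹ • fderiv ℝ f x :=
      (hf.hasFDerivAt.mul ((hasDerivAt_inv hgx).comp_hasFDerivAt x hg.hasFDerivAt)).fderiv
    simp only [pd, h, add_apply, smul_apply, smul_eq_mul]
    field_simp
    ring
  simp only [Dt, hpd, Finset.sum_div, Finset.mul_sum, ← Finset.sum_sub_distrib]
  exact Finset.sum_congr rfl fun μ _ => by ring

/-- **Evolution of `a_0 = π/r`** (first identity of (2.11) in the paper): along solutions of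
equations (i) and (iii) of the Israel–Stewart system,
`D_t(π/r) = [κ(r+1) - 1](π/r) + (κ r² - λ(r^{1/κ}) r^{2+1/κ})(π/r)^{3+1/κ}
  - (ζ(r^{1/κ})/(r π^{1+1/κ})) ∂_μ u^μ` (written out term by term). -/
theorem evolution_a0 (κ : ℝ) (hκ : 0 < κ) (lam zeta : ℝ → ℝ)
    (hlam : Differentiable ℝ lam) (hzeta : Differentiable ℝ zeta)
    (U : Set (Fin 4 → ℝ)) (hU : IsOpen U)
    (r pbar : (Fin 4 → ℝ) → ℝ) (u : (Fin 4 → ℝ) → Fin 4 → ℝ)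
    (hr : DifferentiableOn ℝ r U) (hpbar : DifferentiableOn ℝ pbar U)
    (hu : ∀ μ, DifferentiableOn ℝ (fun x => u x μ) U)
    (hrpos : ∀ x ∈ U, 0 < r x) (hppos : ∀ x ∈ U, 0 < pbar x)
    (heqI : ∀ x ∈ U, EqI κ r u pbar x)
    (heqIII : ∀ x ∈ U, EqIII κ lam zeta r u pbar x) :
    ∀ x ∈ U,
      Dt u (fun y => pbar y / r y) x
        = -(pbar x / r x)
          - lam (r x ^ (1/κ)) * r x ^ ((2:ℝ) + 1/κ) * (pbar x / r x) ^ ((3:ℝ) + 1/κ)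
          - (zeta (r x ^ (1/κ)) / (r x * pbar x ^ ((1:ℝ) + 1/κ))) * divu u x
          + κ * (r x + 1) * (pbar x / r x) * divu u x
          + κ * (r x) ^ 2 * (pbar x / r x) ^ ((3:ℝ) + 1/κ) * divu u x := by
  intro x hx
  have hr0 := hrpos x hx
  have hp0 := hppos x hx
  have hI := heqI x hx
  have hIII := heqIII x hx
  have hxU := hU.mem_nhds hx
  unfold EqI at hI
  unfold EqIII at hIII
  rw [Dt_div u (hpbar.differentiableAt hxU) (hr.differentiableAt hxU) hr0.ne',
    eq_neg_of_add_eq_zero_left hI]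
  have hpow : (pbar x / r x) ^ ((3 : ℝ) + 1 / κ)
      = pbar x / r x * (pbar x / r x) ^ ((2 : ℝ) + 1 / κ) := by
    rw [show (3 : ℝ) + 1 / κ = 1 + (2 + 1 / κ) by ring, Real.rpow_add (div_pos hp0 hr0),
      Real.rpow_one]
  have hlamTerm : r x ^ ((2 : ℝ) + 1 / κ) * (pbar x / r x) ^ ((3 : ℝ) + 1 / κ)
      = pbar x ^ ((3 : ℝ) + 1 / κ) / r x := by
    have hsplit : r x ^ ((3 : ℝ) + 1 / κ) = r x * r x ^ ((2 : ℝ) + 1 / κ) := by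
      rw [show (3 : ℝ) + 1 / κ = 1 + (2 + 1 / κ) by ring, Real.rpow_add hr0, Real.rpow_one]
    have hne := (Real.rpow_pos_of_pos hr0 ((2 : ℝ) + 1 / κ)).ne'
    rw [Real.div_rpow hp0.le hr0.le, hsplit]
    field_simp
  have hDp : Dt u pbar x = -pbar x - lam (r x ^ (1 / κ)) * pbar x ^ ((3 : ℝ) + 1 / κ)
      - r x * (zeta (r x ^ (1 / κ)) / (r x * pbar x ^ ((1 : ℝ) + 1 / κ))) * divu u x := by
    linarith
  rw [mul_assoc (lam _), hlamTerm, hpow, hDp]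
  generalize zeta (r x ^ (1 / κ)) / (r x * pbar x ^ ((1 : ℝ) + 1 / κ)) = a
  generalize (pbar x / r x) ^ ((2 : ℝ) + 1 / κ) = b
  generalize pbar x ^ ((3 : ℝ) + 1 / κ) = c
  generalize lam (r x ^ (1 / κ)) = l
  have hr0' := hr0.ne'
  field_simp
  ring
end

section
/- Let κ > 0, let U ⊂ ℝ^{1+3} be open, let r, π : U → ℝ be continuously differentiable with r, π > 0 on U, and let r̃ : U → ℝ and ũ : U → ℝ^4 be continuously differentiable. With a_0 = π/r and a_1 = r + 1 + r^2 a_0^{2+1/κ}, the following pointwise identity holds on U: κ r^{1/κ} a_1 (∂_μ ũ^μ) r̃ + r^{1/κ-1} (∂_μ r) ũ^μ r̃ + κ r^{1/κ} a_1 (∂_μ r̃) ũ^μ = κ ∂_μ( r^{1/κ} a_1 r̃ ũ^μ ) - r^{1/κ} [ (1+κ) ∂_μ r + (2κ+1) r a_0^{1+1/κ} ∂_μ π ] r̃ ũ^μ, where repeated indices μ are summed over 0..3 and ∂_μ = ∂/∂x^μ. -/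
open Set

/-- The weight `r^s (r + 1 + r² (p/r)^{2+s})` is a sum of pure powers. -/
theorem rpow_mul_weight_eq {r p : ℝ} (hr : 0 < r) (hp : 0 < p) (s : ℝ) :
    r ^ s * (r + 1 + r ^ 2 * (p / r) ^ ((2:ℝ) + s)) = r ^ (s + 1) + r ^ s + p ^ ((2:ℝ) + s) := by
  have hs : r ^ s ≠ 0 := (Real.rpow_pos_of_pos hr s).ne'
  rw [Real.div_rpow hp.le hr.le, Real.rpow_add hr, Real.rpow_add hr, Real.rpow_one,
    Real.rpow_two]
  field_simp

theorem rpow_mul_mul_div_rpow {r p : ℝ} (hr : 0 < r) (hp : 0 < p) (s : ℝ) :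
    r ^ s * (r * (p / r) ^ ((1:ℝ) + s)) = p ^ ((1:ℝ) + s) := by
  have hs : r ^ s ≠ 0 := (Real.rpow_pos_of_pos hr s).ne'
  rw [Real.div_rpow hp.le hr.le, Real.rpow_add hr, Real.rpow_one]
  field_simp

theorem hasFDerivAt_rpow_mul_weight {E : Type*} [NormedAddCommGroup E] [NormedSpace ℝ E]
    {r p : E → ℝ} {r' p' : E →L[ℝ] ℝ} {x : E} (hr : HasFDerivAt r r' x)
    (hp : HasFDerivAt p p' x) (hr0 : 0 < r x) (hp0 : 0 < p x) (s : ℝ) :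
    HasFDerivAt (fun y => r y ^ s * (r y + 1 + r y ^ 2 * (p y / r y) ^ ((2:ℝ) + s)))
      (((s + 1) * r x ^ s + s * r x ^ (s - 1)) • r' + ((2 + s) * p x ^ (1 + s)) • p') x := by
  have h := ((hr.rpow_const (p := s + 1) (.inl hr0.ne')).add
    (hr.rpow_const (p := s) (.inl hr0.ne'))).add (hp.rpow_const (p := 2 + s) (.inl hp0.ne'))
  rw [add_sub_cancel_right, show 2 + s - 1 = 1 + s by ring, ← add_smul] at h
  refine h.congr_of_eventuallyEq ?_
  filter_upwards [hr.continuousAt.eventually_const_lt hr0,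
    hp.continuousAt.eventually_const_lt hp0] with y hry hpy
  exact rpow_mul_weight_eq hry hpy s

/-- **The "blue terms" form a perfect divergence** (identity (2.10) of the paper):
with `a_0 = π/r` and `a_1 = r + 1 + r² a_0^{2+1/κ}`,
`κ r^{1/κ} a_1 (∂_μ ũ^μ) r̃ + r^{1/κ-1} (∂_μ r) ũ^μ r̃ + κ r^{1/κ} a_1 (∂_μ r̃) ũ^μ
  = κ ∂_μ(r^{1/κ} a_1 r̃ ũ^μ) - r^{1/κ}[(1+κ) ∂_μ r + (2κ+1) r a_0^{1+1/κ} ∂_μ π] r̃ ũ^μ`. -/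
theorem blue_terms_perfect_divergence (κ : ℝ) (hκ : 0 < κ)
    (U : Set (Fin 4 → ℝ)) (hU : IsOpen U)
    (r pbar rt : (Fin 4 → ℝ) → ℝ) (ut : (Fin 4 → ℝ) → Fin 4 → ℝ)
    (hr : ContDiffOn ℝ 1 r U) (hpbar : ContDiffOn ℝ 1 pbar U)
    (hrt : ContDiffOn ℝ 1 rt U) (hut : ∀ μ, ContDiffOn ℝ 1 (fun x => ut x μ) U)
    (hrpos : ∀ x ∈ U, 0 < r x) (hppos : ∀ x ∈ U, 0 < pbar x) :
    ∀ x ∈ U,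
      κ * r x ^ (1/κ) * (r x + 1 + (r x) ^ 2 * (pbar x / r x) ^ ((2:ℝ) + 1/κ))
          * (∑ μ, pd μ (fun y => ut y μ) x) * rt x
        + r x ^ (1/κ - 1) * (∑ μ, pd μ r x * ut x μ) * rt x
        + κ * r x ^ (1/κ) * (r x + 1 + (r x) ^ 2 * (pbar x / r x) ^ ((2:ℝ) + 1/κ))
          * (∑ μ, pd μ rt x * ut x μ)
      = κ * (∑ μ, pd μ (fun y =>
            r y ^ (1/κ) * (r y + 1 + (r y) ^ 2 * (pbar y / r y) ^ ((2:ℝ) + 1/κ))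
              * rt y * ut y μ) x)
        - r x ^ (1/κ) * (∑ μ, ((1 + κ) * pd μ r x
            + (2 * κ + 1) * r x * (pbar x / r x) ^ ((1:ℝ) + 1/κ) * pd μ pbar x)
              * rt x * ut x μ) := by
  intro x hx
  have hUx : U ∈ nhds x := hU.mem_nhds hx
  have hasD {f : (Fin 4 → ℝ) → ℝ} (hf : ContDiffOn ℝ 1 f U) : HasFDerivAt f (fderiv ℝ f x) x :=
    ((hf.contDiffAt hUx).differentiableAt one_ne_zero).hasFDerivAt
  have hw := hasFDerivAt_rpow_mul_weight (hasD hr) (hasD hpbar) (hrpos x hx) (hppos x hx) (1/κ)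
  have hprod (μ : Fin 4) := ((hw.mul (hasD hrt)).mul (hasD (hut μ))).fderiv
  have hcancel := rpow_mul_mul_div_rpow (hrpos x hx) (hppos x hx) (1/κ)
  have hκ1 : κ * (1/κ) = 1 := mul_one_div_cancel hκ.ne'
  simp only [Finset.mul_sum, Finset.sum_mul, ← Finset.sum_add_distrib, ← Finset.sum_sub_distrib]
  refine Finset.sum_congr rfl fun μ _ => ?_
  have hpd := congrArg (fun L => L (Pi.single μ 1)) (hprod μ)
  simp only [Pi.mul_def, add_apply, smul_apply, smul_eq_mul] at hpd
  simp only [pd]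
  rw [hpd]
  generalize fderiv ℝ r x (Pi.single μ 1) = dr
  generalize fderiv ℝ pbar x (Pi.single μ 1) = dp
  generalize 1/κ = s at *
  linear_combination
    (-(r x ^ s + r x ^ (s - 1)) * dr - pbar x ^ (1 + s) * dp) * rt x * ut x μ * hκ1
      + (2 * κ + 1) * dp * rt x * ut x μ * hcancel
end
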